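/- Suppose p > 2. Let a11 ∈ F_q^× and b3,b5,b6,b7 ∈ F_q, with λ(t3,t5,t6,t7,t8,t9,t10,t11) = φ(b5·t5 + b6·t6 + b7·t7 + a11·t11) on K = {0}×V and χ(x(t)) = φ(b3·t3)·λ^H(x(t)). Then: (i) at t with t1 = t2 = t3 = t4 = t8 = t9 = t10 = 0 and t5,t6,t7 ∈ F_q^×, χ(x(t)) = q·φ(b5·t5 + b6·t6 + b7·t7 + a11·t11)·∑_{s∈F_q} φ(−a11·t5·t6·t7·s^2); (ii) at t with t1 = t2 = t3 = t4 = t7 = t8 = 0 and t5 ∈ F_q^×, χ(x(t)) = q^2·φ(b5·t5 + b6·t6 + a11·t11) if t6·t9 = t5·t10, and 0 otherwise; (iii) at t with t1 = t2 = t3 = t4 = t5 = t6 = t7 = 0, χ(x(t)) = q^3·φ(a11·t11) if t8 = t9 = t10 = 0, and 0 otherwise. -/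

import Mathlib

open Finset
open scoped Classical

noncomputable section

/-- The additive character `φ(x) = exp(2πi·Tr(x)/p)` of `F_q`, where `Tr` is the trace to `F_p`. -/
def phi (p : ℕ) (F : Type) [Field F] [Fintype F] [Algebra (ZMod p) F] (x : F) : ℂ :=
  Complex.exp (2 * Real.pi * Complex.I * ((Algebra.trace (ZMod p) F x).val : ℂ) / (p : ℂ))

namespace UM12

variable (F : Type) [Field F] [Fintype F]

/- `V = F_q^8` has coordinates `(t3,t5,t6,t7,t8,t9,t10,t11)`, indexed `0,…,7`. -/

/-- `σ1(s) : t5 ↦ t5 − s·t3, t8 ↦ t8 − s·t6, t9 ↦ t9 − s·t7, t11 ↦ t11 − s·t10`. -/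
def sig1 (s : F) (v : Fin 8 → F) : Fin 8 → F :=
  ![v 0, v 1 - s * v 0, v 2, v 3, v 4 - s * v 2, v 5 - s * v 3, v 6, v 7 - s * v 6]

/-- `σ2(s) : t6 ↦ t6 − s·t3, t8 ↦ t8 − s·t5, t10 ↦ t10 − s·t7, t11 ↦ t11 − s·t9`. -/
def sig2 (s : F) (v : Fin 8 → F) : Fin 8 → F :=
  ![v 0, v 1, v 2 - s * v 0, v 3, v 4 - s * v 1, v 5, v 6 - s * v 3, v 7 - s * v 5]

/-- `σ4(s) : t7 ↦ t7 − s·t3, t9 ↦ t9 − s·t5, t10 ↦ t10 − s·t6, t11 ↦ t11 − s·t8`. -/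
def sig4 (s : F) (v : Fin 8 → F) : Fin 8 → F :=
  ![v 0, v 1, v 2, v 3 - s * v 0, v 4, v 5 - s * v 1, v 6 - s * v 2, v 7 - s * v 4]

/-- The composite action `σ1(s1)σ2(s2)σ4(s4)` of `F_q^3` on `V`. -/
def sigma (s : Fin 3 → F) (v : Fin 8 → F) : Fin 8 → F :=
  sig1 F (s 0) (sig2 F (s 1) (sig4 F (s 2) v))

/-- Multiplication in the semidirect product `H = F_q^3 ⋉ V`:
conjugating `(0,v)` by `(s,0)` yields `(0, σ1(s1)σ2(s2)σ4(s4)(v))`. -/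
def Hmul (x y : (Fin 3 → F) × (Fin 8 → F)) : (Fin 3 → F) × (Fin 8 → F) :=
  (x.1 + y.1, sigma F y.1 x.2 + y.2)

/-- Inversion in `H`. -/
def Hinv (x : (Fin 3 → F) × (Fin 8 → F)) : (Fin 3 → F) × (Fin 8 → F) :=
  (-x.1, -(sigma F (-x.1) x.2))

/-- Conjugation `x⁻¹ h x` in `H`. -/
def Hconj (x h : (Fin 3 → F) × (Fin 8 → F)) : (Fin 3 → F) × (Fin 8 → F) :=
  Hmul F (Hmul F (Hinv F x) h) x

/-- The element `x(t) = (0,(t3,0,…,0))·((t1,t2,t4),0)·(0,(0,t5,t6,t7,t8,t9,t10,t11))` of `H`,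
for `t = (t1,…,t11)` (indexed `0,…,10`). -/
def xelt (t : Fin 11 → F) : (Fin 3 → F) × (Fin 8 → F) :=
  Hmul F
    (Hmul F ((0 : Fin 3 → F), ![t 2, 0, 0, 0, 0, 0, 0, 0]) (![t 0, t 1, t 3], (0 : Fin 8 → F)))
    ((0 : Fin 3 → F), ![0, t 4, t 5, t 6, t 7, t 8, t 9, t 10])

/-- The extension by zero `λ̇` to `H` of a function `λ` on `K = {0} × V`. -/
def lamDot (lam : (Fin 8 → F) → ℂ) (h : (Fin 3 → F) × (Fin 8 → F)) : ℂ :=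
  if h.1 = 0 then lam h.2 else 0

/-- The induced class function `λ^H(h) = (1/q^8) ∑_{x∈H} λ̇(x⁻¹ h x)`. -/
def ind (lam : (Fin 8 → F) → ℂ) (h : (Fin 3 → F) × (Fin 8 → F)) : ℂ :=
  (1 / (Fintype.card F : ℂ) ^ 8) * ∑ x : (Fin 3 → F) × (Fin 8 → F), lamDot F lam (Hconj F x h)

end UM12
namespace UM12

lemma sum_fin_three {F : Type} [Fintype F] (f : (Fin 3 → F) → ℂ) :
    ∑ s, f s = ∑ x : F, ∑ y : F, ∑ z : F, f ![x, y, z] := by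
  let e : F × F × F ≃ (Fin 3 → F) :=
    { toFun := fun u => ![u.1, u.2.1, u.2.2]
      invFun := fun s => (s 0, s 1, s 2)
      left_inv := fun _ => rfl
      right_inv := fun s => by ext i; fin_cases i <;> rfl }
  rw [← e.sum_comp f, Fintype.sum_prod_type]
  simp only [Fintype.sum_prod_type]
  rfl

section Conjugation

variable {F : Type} [Field F]

lemma sigma_conj_cancel (s : Fin 3 → F) (w v : Fin 8 → F) :
    sigma F s (-(sigma F (-s) w) + v) + w = sigma F s v := by
  ext i
  fin_cases i <;> simp [sigma, sig1, sig2, sig4] <;> ring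

lemma sigma_zero (v : Fin 8 → F) : sigma F 0 v = v := by
  ext i
  fin_cases i <;> simp [sigma, sig1, sig2, sig4]

lemma Hconj_zero_fst [Fintype F] (x : (Fin 3 → F) × (Fin 8 → F)) (v : Fin 8 → F) :
    Hconj F x (0, v) = (0, sigma F x.1 v) := by
  simp [Hconj, Hmul, Hinv, sigma_zero, sigma_conj_cancel]

lemma xelt_of_mem_K (t5 t6 t7 t8 t9 t10 t11 : F) :
    xelt F ![0, 0, 0, 0, t5, t6, t7, t8, t9, t10, t11] =
      (0, ![0, t5, t6, t7, t8, t9, t10, t11]) := by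
  ext i
  · fin_cases i <;> simp [xelt, Hmul]
  · fin_cases i <;> simp [xelt, Hmul, sigma, sig1, sig2, sig4]

lemma ind_zero_fst [Fintype F] (lam : (Fin 8 → F) → ℂ) (v : Fin 8 → F) :
    ind F lam (0, v) = ∑ x : F, ∑ y : F, ∑ z : F, lam (sigma F ![x, y, z] v) := by
  have hq : (Fintype.card F : ℂ) ≠ 0 := Nat.cast_ne_zero.mpr Fintype.card_ne_zero
  rw [← sum_fin_three fun s => lam (sigma F s v)]
  simp only [ind, Hconj_zero_fst, lamDot, if_true, Fintype.sum_prod_type, sum_const, card_univ,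
    Fintype.card_fun, Fintype.card_fin, nsmul_eq_mul, Nat.cast_pow, ← mul_sum]
  field_simp

end Conjugation

section Character

variable (p : ℕ) [Fact p.Prime] (F : Type) [Field F] [Fintype F] [Algebra (ZMod p) F]

/-- `phi` as an additive character. -/
def phiChar : AddChar F ℂ :=
  (ZMod.stdAddChar (N := p)).compAddMonoidHom (Algebra.trace (ZMod p) F).toAddMonoidHom

lemma phiChar_apply (x : F) : phiChar p F x = phi p F x := by
  have h := ZMod.stdAddChar_coe (N := p) ((Algebra.trace (ZMod p) F x).val : ℤ)
  rw [Int.cast_natCast, ZMod.natCast_zmod_val] at h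
  simpa [phiChar, phi] using h

lemma phiChar_isPrimitive : (phiChar p F).IsPrimitive := by
  have : Module.Finite (ZMod p) F := Module.Finite.of_finite
  apply AddChar.IsPrimitive.of_ne_one
  intro h
  obtain ⟨x, hx⟩ := Algebra.trace_surjective (ZMod p) F 1
  have h1 : ZMod.stdAddChar (N := p) 1 = ZMod.stdAddChar (N := p) 0 := by
    have := DFunLike.congr_fun h x
    simpa [phiChar, hx] using this
  exact one_ne_zero (ZMod.injective_stdAddChar h1)

end Character

section CharacterSums

variable {F : Type} [Field F] [Fintype F] {ψ : AddChar F ℂ}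

lemma sum_addChar_mul (hψ : ψ.IsPrimitive) (b : F) :
    ∑ x, ψ (x * b) = if b = 0 then (Fintype.card F : ℂ) else 0 := by
  rw [AddChar.sum_mulShift b hψ]
  split_ifs <;> simp

/-- Summing out the last variable, then the second one, when the coefficient `c` of their
product is nonzero. -/
lemma sum_addChar_quadratic (hψ : ψ.IsPrimitive) {a c : F} (ha : a ≠ 0) (hc : c ≠ 0)
    (d e k l m : F) :
    ∑ x, ∑ y, ∑ z, ψ (m + a * (y * z * c + x * z * d + x * y * e - y * k - x * l)) =
      Fintype.card F * ψ m *
        ∑ x, ψ (x * (a * (d * k - c * l)) + -(a * c * d * e) * x ^ 2) := by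
  have inner (x y : F) :
      ∑ z, ψ (m + a * (y * z * c + x * z * d + x * y * e - y * k - x * l)) =
        if y = -(x * d / c) then
          Fintype.card F * ψ (m + a * (x * y * e - y * k - x * l)) else 0 := by
    have hz (z : F) : ψ (m + a * (y * z * c + x * z * d + x * y * e - y * k - x * l)) =
        ψ (z * (a * (y * c + x * d))) * ψ (m + a * (x * y * e - y * k - x * l)) := by
      rw [← AddChar.map_add_eq_mul]
      congr 1
      ring
    have hy : a * (y * c + x * d) = 0 ↔ y = -(x * d / c) := by
      rw [mul_eq_zero, or_iff_right ha, ← neg_div, eq_div_iff hc, eq_neg_iff_add_eq_zero]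
    simp_rw [hz, ← sum_mul, sum_addChar_mul hψ, hy]
    split_ifs <;> simp
  simp_rw [inner, sum_ite_eq' univ, mem_univ, if_true]
  rw [mul_assoc, mul_sum, mul_sum]
  refine (Fintype.sum_equiv (Equiv.mulLeft₀ c hc) _ _ fun x => ?_).symm
  rw [← AddChar.map_add_eq_mul]
  congr 2
  simp only [Equiv.mulLeft₀_apply]
  field_simp
  ring

end CharacterSums

lemma phi_mul_ind_xelt (p : ℕ) [Fact p.Prime] (F : Type) [Field F] [Fintype F]
    [Algebra (ZMod p) F] (a11 b3 b5 b6 b7 t5 t6 t7 t8 t9 t10 t11 : F) :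
    phi p F (b3 * (0 : F)) *
        ind F (fun v => phi p F (b5 * v 1 + b6 * v 2 + b7 * v 3 + a11 * v 7))
          (xelt F ![0, 0, 0, 0, t5, t6, t7, t8, t9, t10, t11]) =
      ∑ x, ∑ y, ∑ z, phiChar p F (b5 * t5 + b6 * t6 + b7 * t7 + a11 * t11 +
        a11 * (y * z * t5 + x * z * t6 + x * y * t7 - y * t9 - x * t10 - z * t8)) := by
  rw [xelt_of_mem_K, ind_zero_fst, mul_zero, ← phiChar_apply, AddChar.map_zero_eq_one, one_mul]
  refine sum_congr rfl fun x _ => sum_congr rfl fun y _ => sum_congr rfl fun z _ => ?_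
  rw [← phiChar_apply]
  congr 1
  simp [sigma, sig1, sig2, sig4]
  ring

end UM12

open UM12 in
/-- further values of `χ(x(t)) = φ(b3·t3)·λ^H(x(t))`, where
`λ(t3,t5,t6,t7,t8,t9,t10,t11) = φ(b5·t5 + b6·t6 + b7·t7 + a11·t11)` on `K = {0}×V`,
for `p > 2`: parts (i), (ii), (iii). -/
theorem stmt16 (p : ℕ) [Fact p.Prime] (hp : 2 < p) (F : Type) [Field F] [Fintype F] [CharP F p]
    [Algebra (ZMod p) F] (a11 : F) (h11 : a11 ≠ 0) (b3 b5 b6 b7 : F) :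
    (∀ t5 t6 t7 t11 : F, t5 ≠ 0 → t6 ≠ 0 → t7 ≠ 0 →
      phi p F (b3 * (0 : F)) *
        ind F (fun v => phi p F (b5 * v 1 + b6 * v 2 + b7 * v 3 + a11 * v 7))
          (xelt F ![0, 0, 0, 0, t5, t6, t7, 0, 0, 0, t11]) =
      (Fintype.card F : ℂ) * phi p F (b5 * t5 + b6 * t6 + b7 * t7 + a11 * t11) *
        ∑ s : F, phi p F (-(a11 * t5 * t6 * t7) * s ^ 2)) ∧
    (∀ t5 t6 t9 t10 t11 : F, t5 ≠ 0 →
      phi p F (b3 * (0 : F)) *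
        ind F (fun v => phi p F (b5 * v 1 + b6 * v 2 + b7 * v 3 + a11 * v 7))
          (xelt F ![0, 0, 0, 0, t5, t6, 0, 0, t9, t10, t11]) =
      if t6 * t9 = t5 * t10 then
        (Fintype.card F : ℂ) ^ 2 * phi p F (b5 * t5 + b6 * t6 + a11 * t11)
      else 0) ∧
    (∀ t8 t9 t10 t11 : F,
      phi p F (b3 * (0 : F)) *
        ind F (fun v => phi p F (b5 * v 1 + b6 * v 2 + b7 * v 3 + a11 * v 7))
          (xelt F ![0, 0, 0, 0, 0, 0, 0, t8, t9, t10, t11]) =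
      if t8 = 0 ∧ t9 = 0 ∧ t10 = 0 then
        (Fintype.card F : ℂ) ^ 3 * phi p F (a11 * t11)
      else 0) := by
  have hψ := phiChar_isPrimitive p F
  refine ⟨fun t5 t6 t7 t11 h5 _ _ => ?_, fun t5 t6 t9 t10 t11 h5 => ?_,
    fun t8 t9 t10 t11 => ?_⟩ <;> rw [phi_mul_ind_xelt] <;> simp_rw [← phiChar_apply]
  · have h := sum_addChar_quadratic hψ h11 h5 t6 t7 0 0
      (b5 * t5 + b6 * t6 + b7 * t7 + a11 * t11)
    simpa using h
  · have h := sum_addChar_quadratic hψ h11 h5 t6 0 t9 t10 (b5 * t5 + b6 * t6 + a11 * t11)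
    simp only [mul_zero, add_zero, neg_zero, zero_mul, sub_zero, sum_addChar_mul hψ,
      mul_eq_zero, h11, false_or, sub_eq_zero] at h ⊢
    rw [h]
    split_ifs <;> ring
  · have factor (x y z : F) : phiChar p F (b5 * 0 + b6 * 0 + b7 * 0 + a11 * t11 +
        a11 * (y * z * 0 + x * z * 0 + x * y * 0 - y * t9 - x * t10 - z * t8)) =
        phiChar p F (a11 * t11) * (phiChar p F (x * -(a11 * t10)) *
          (phiChar p F (y * -(a11 * t9)) * phiChar p F (z * -(a11 * t8)))) := by
      simp only [← AddChar.map_add_eq_mul]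
      congr 1
      ring
    simp_rw [factor, ← mul_sum, ← sum_mul, sum_addChar_mul hψ, neg_eq_zero, mul_eq_zero, h11,
      false_or]
    by_cases h8 : t8 = 0 <;> by_cases h9 : t9 = 0 <;> by_cases h10 : t10 = 0 <;>
      simp [h8, h9, h10]
    ring
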